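/- arXiv:math/0309236 — 2 statements merged into one kernel-verified Lean document; each statement's English description precedes it below -/
import Mathlib

section
/- Let H be an infinite-dimensional separable real or complex Hilbert space and let B be a positive non-compact bounded operator on H. If {c_i}_{i=1}^∞ is a bounded sequence of positive real numbers with sup_i c_i < ‖B‖_ess and Σ_i c_i = ∞, then there exists a sequence {P_i}_{i=1}^∞ of rank-one orthogonal projections on H such that B = Σ_{i=1}^∞ c_i P_i, with convergence in the strong operator topology. -/
open scoped InnerProductSpace

/-- The rank-one operator `u ⊗ v : x ↦ ⟨x, v⟩ u` (inner product linear in `x`). -/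
noncomputable def rankOne (𝕜 : Type*) {H : Type*} [RCLike 𝕜] [NormedAddCommGroup H]
    [InnerProductSpace 𝕜 H] (u v : H) : H →L[𝕜] H :=
  (innerSL 𝕜 v).smulRight u

/-- The essential norm of a bounded operator: `‖B‖_ess = inf {‖B - K‖ : K compact}`. -/
noncomputable def essNorm {𝕜 H : Type*} [RCLike 𝕜] [NormedAddCommGroup H]
    [InnerProductSpace 𝕜 H] (B : H →L[𝕜] H) : ℝ :=
  sInf ((fun K => ‖B - K‖) '' {K : H →L[𝕜] H | IsCompactOperator K})

section Factorization

open ContinuousLinearMap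

universe u v

/-- A positive operator `B` factors as `S† S` for some operator `S` into a Hilbert space. -/
theorem ContinuousLinearMap.IsPositive.exists_adjoint_comp_eq {𝕜 : Type u} {H : Type v} [RCLike 𝕜]
    [NormedAddCommGroup H] [InnerProductSpace 𝕜 H] [CompleteSpace H] {B : H →L[𝕜] H}
    (hB : B.IsPositive) :
    ∃ (E : Type (max u v)) (_ : NormedAddCommGroup E) (_ : InnerProductSpace 𝕜 E)
      (_ : CompleteSpace E) (S : H →L[𝕜] E), adjoint S ∘L S = B := by
  let K : Matrix PUnit.{1} PUnit.{1} (H →L[𝕜] H) := .of fun _ _ => B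
  have hK : K.PosSemidef := by
    have key := (RKHS.posSemidef_tfae (K := K)).out 0 2
    refine key.mpr ⟨?_, fun f => ?_⟩
    · ext1 i j
      exact hB.isSelfAdjoint
    · have hf : f = Finsupp.single PUnit.unit (f PUnit.unit) := by
        ext
        simp
      rw [hf]
      simpa [K] using hB.re_inner_nonneg_left (f PUnit.unit)
  have : Fact K.PosSemidef := ⟨hK⟩
  refine ⟨RKHS.OfKernel K, inferInstance, inferInstance, inferInstance,
    RKHS.kerFun (RKHS.OfKernel K) PUnit.unit, ?_⟩
  rw [← RKHS.kernel_apply, RKHS.OfKernel.kernel_ofKernel]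
  rfl

end Factorization

section EssentialNorm

open ContinuousLinearMap

variable {𝕜 H K : Type*} [RCLike 𝕜] [NormedAddCommGroup H] [InnerProductSpace 𝕜 H]
  [NormedAddCommGroup K] [InnerProductSpace 𝕜 K]

theorem essNorm_le_norm_sub (B : H →L[𝕜] H) {T : H →L[𝕜] H} (hT : IsCompactOperator T) :
    essNorm B ≤ ‖B - T‖ :=
  csInf_le ⟨0, by rintro _ ⟨L, -, rfl⟩; exact norm_nonneg _⟩ ⟨T, hT, rfl⟩

theorem isCompactOperator_starProjection (M : Submodule 𝕜 K) [FiniteDimensional 𝕜 M] :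
    IsCompactOperator M.starProjection := by
  have : ProperSpace M := FiniteDimensional.proper 𝕜 M
  exact (isCompactOperator_id (E := M)).comp_clm M.orthogonalProjectionOnto |>.clm_comp M.subtypeL

/-- If `a < ‖C C†‖_ess`, the orthogonal complement of any finite-dimensional subspace contains a
unit vector `g` with `‖C g‖² > a`. -/
theorem exists_mem_orthogonal_lt_norm_sq_of_lt_essNorm [CompleteSpace H] [CompleteSpace K]
    (C : K →L[𝕜] H) {a : ℝ} (ha : 0 ≤ a) (h : a < essNorm (C ∘L adjoint C))
    (M : Submodule 𝕜 K) [FiniteDimensional 𝕜 M] :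
    ∃ g ∈ Mᗮ, ‖g‖ = 1 ∧ a < ‖C g‖ ^ 2 := by
  by_contra! hcon
  have hbound : ∀ g ∈ Mᗮ, ‖C g‖ ≤ √a * ‖g‖ := by
    intro g hg
    rcases eq_or_ne g 0 with rfl | hg0
    · simp
    have hn : ‖g‖ ≠ 0 := norm_ne_zero_iff.mpr hg0
    have h1 := hcon (((‖g‖⁻¹ : ℝ) : 𝕜) • g) (Mᗮ.smul_mem _ hg) (by
      rw [norm_smul]; simp [hn])
    have h2 := Real.le_sqrt_of_sq_le h1
    rw [map_smul, norm_smul] at h2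
    simp only [RCLike.norm_ofReal, abs_inv, abs_norm] at h2
    rwa [inv_mul_le_iff₀ (by positivity), mul_comm] at h2
  set T : K →L[𝕜] H := C ∘L Mᗮ.starProjection with hT
  have hTn : ‖T‖ ≤ √a := by
    refine T.opNorm_le_bound (Real.sqrt_nonneg a) fun x => ?_
    refine (hbound _ (Submodule.starProjection_apply_mem _ x)).trans ?_
    exact mul_le_mul_of_nonneg_left (Submodule.norm_starProjection_apply_le _ x)
      (Real.sqrt_nonneg a)
  have hTT : T ∘L adjoint T = C ∘L adjoint C - C ∘L M.starProjection ∘L adjoint C := by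
    have h1 : adjoint T = Mᗮ.starProjection ∘L adjoint C := by
      rw [hT, adjoint_comp]
      congr 1
      exact isSelfAdjoint_starProjection Mᗮ
    rw [h1, hT]
    ext x
    have h2 : Mᗮ.starProjection (Mᗮ.starProjection (adjoint C x))
        = adjoint C x - M.starProjection (adjoint C x) := by
      rw [Submodule.starProjection_eq_self_iff.mpr (Submodule.starProjection_apply_mem _ _),
        Submodule.starProjection_orthogonal_val]
    simp only [coe_comp, Function.comp_apply, sub_apply, h2, map_sub]
  have hcomp : IsCompactOperator (C ∘L M.starProjection ∘L adjoint C) :=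
    ((isCompactOperator_starProjection M).comp_clm (adjoint C)).clm_comp C
  have h1 := essNorm_le_norm_sub (C ∘L adjoint C) hcomp
  rw [← hTT] at h1
  have h2 : ‖T ∘L adjoint T‖ ≤ √a * √a := by
    refine (opNorm_comp_le _ _).trans ?_
    rw [LinearIsometryEquiv.norm_map]
    gcongr
  rw [Real.mul_self_sqrt ha] at h2
  linarith

end EssentialNorm

section Mixing

open ContinuousLinearMap

variable {𝕜 H K : Type*} [RCLike 𝕜] [NormedAddCommGroup H] [InnerProductSpace 𝕜 H]
  [NormedAddCommGroup K] [InnerProductSpace 𝕜 K]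

theorem norm_sq_ofReal_smul_add_ofReal_smul {u v : K} (h : ⟪u, v⟫_𝕜 = 0) (α β : ℝ) :
    ‖(α : 𝕜) • u + (β : 𝕜) • v‖ ^ 2 = α ^ 2 * ‖u‖ ^ 2 + β ^ 2 * ‖v‖ ^ 2 := by
  rw [norm_add_sq (𝕜 := 𝕜), inner_smul_left, inner_smul_right, h, norm_smul, norm_smul]
  simp [mul_pow]

/-- Rotating inside the plane spanned by `r` and a unit vector `g`, which is orthogonal to `r` for
both the inner product and the form `⟪C ·, C ·⟫`. -/
theorem exists_unit_mixture (C : K →L[𝕜] H) {r g : K} (hr : r ≠ 0) (hg : ‖g‖ = 1)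
    (hrg : ⟪r, g⟫_𝕜 = 0) (hC : ⟪C r, C g⟫_𝕜 = 0) {t b p : ℝ} (ht : ‖C r‖ ^ 2 = t * ‖r‖ ^ 2)
    (hb : ‖C g‖ ^ 2 = b) (hp0 : 0 ≤ p) (hp1 : p ≤ 1) :
    ∃ y : K, (∀ z : K, ⟪z, r⟫_𝕜 = 0 → ⟪z, g⟫_𝕜 = 0 → ⟪z, y⟫_𝕜 = 0) ∧ ‖y‖ = 1 ∧
      ‖C y‖ ^ 2 = p * t + (1 - p) * b ∧
      ‖r - ⟪y, r⟫_𝕜 • y‖ ^ 2 = (1 - p) * ‖r‖ ^ 2 ∧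
      ‖C (r - ⟪y, r⟫_𝕜 • y)‖ ^ 2 = ((1 - p) * t + p * b) * ((1 - p) * ‖r‖ ^ 2) := by
  have hn : ‖r‖ ≠ 0 := norm_ne_zero_iff.mpr hr
  set α : ℝ := √p / ‖r‖ with hα
  set β : ℝ := √(1 - p) with hβ
  have hα2 : α ^ 2 * ‖r‖ ^ 2 = p := by
    rw [hα, div_pow, Real.sq_sqrt hp0]
    field_simp
  have hβ2 : β ^ 2 = 1 - p := Real.sq_sqrt (by linarith)
  have hinner : ⟪(α : 𝕜) • r + (β : 𝕜) • g, r⟫_𝕜 = ((α * ‖r‖ ^ 2 : ℝ) : 𝕜) := by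
    have hgr : ⟪g, r⟫_𝕜 = 0 := inner_eq_zero_symm.mp hrg
    rw [inner_add_left, inner_smul_left, inner_smul_left, hgr, inner_self_eq_norm_sq_to_K]
    simp
  have hres : r - ⟪(α : 𝕜) • r + (β : 𝕜) • g, r⟫_𝕜 • ((α : 𝕜) • r + (β : 𝕜) • g)
      = ((1 - p : ℝ) : 𝕜) • r + ((-(α * ‖r‖ ^ 2 * β) : ℝ) : 𝕜) • g := by
    rw [hinner, ← hα2]
    push_cast
    module
  refine ⟨(α : 𝕜) • r + (β : 𝕜) • g, ?_, ?_, ?_, ?_, ?_⟩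
  · intro z hzr hzg
    simp [inner_add_right, inner_smul_right, hzr, hzg]
  · have h := norm_sq_ofReal_smul_add_ofReal_smul hrg α β
    rw [hα2, hβ2, hg] at h
    exact (sq_eq_sq₀ (norm_nonneg _) zero_le_one).mp (by rw [h]; ring)
  · rw [map_add, map_smul, map_smul, norm_sq_ofReal_smul_add_ofReal_smul hC, ht, hb, hβ2, ← hα2]
    ring
  · rw [hres, norm_sq_ofReal_smul_add_ofReal_smul hrg, hg]
    linear_combination (‖r‖ ^ 2 * β ^ 2) * hα2 + p * ‖r‖ ^ 2 * hβ2
  · rw [hres, map_add, map_smul, map_smul, norm_sq_ofReal_smul_add_ofReal_smul hC, ht, hb]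
    linear_combination (‖r‖ ^ 2 * β ^ 2 * b) * hα2 + p * ‖r‖ ^ 2 * b * hβ2

end Mixing

section Greedy

open ContinuousLinearMap

variable {𝕜 H K : Type*} [RCLike 𝕜] [NormedAddCommGroup H] [InnerProductSpace 𝕜 H]
  [NormedAddCommGroup K] [InnerProductSpace 𝕜 K]

section Step

variable (C : K →L[𝕜] H)
  (hker : ∀ M : Submodule 𝕜 K, FiniteDimensional 𝕜 M → ∃ g ∈ Mᗮ, ‖g‖ = 1 ∧ C g = 0)

include hker in
/-- If the form value of `r` is at least `c`, a suitable unit vector of form value `c` decreases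
the form value of the residual of `r` by `c`. -/
theorem exists_unit_step_of_le (M : Submodule 𝕜 K) [FiniteDimensional 𝕜 M] {c t : ℝ} (hc : 0 < c)
    (hct : c ≤ t) {r : K} (hr : r ≠ 0) (hrM : r ∈ Mᗮ) (ht : ‖C r‖ ^ 2 = t * ‖r‖ ^ 2) :
    ∃ y ∈ Mᗮ, ‖y‖ = 1 ∧ ‖C y‖ ^ 2 = c ∧ ‖r - ⟪y, r⟫_𝕜 • y‖ ^ 2 ≤ ‖r‖ ^ 2 ∧
      ‖C (r - ⟪y, r⟫_𝕜 • y)‖ ^ 2 = (t - c) * ‖r - ⟪y, r⟫_𝕜 • y‖ ^ 2 := by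
  have ht0 : 0 < t := hc.trans_le hct
  obtain ⟨g, hgM, hg1, hg0⟩ := hker (M ⊔ 𝕜 ∙ r) inferInstance
  rw [← Submodule.inf_orthogonal, Submodule.mem_inf,
    Submodule.mem_orthogonal_singleton_iff_inner_right] at hgM
  obtain ⟨y, hy, hy1, hyc, hyr, hyC⟩ := exists_unit_mixture C hr hg1 hgM.2 (by simp [hg0])
    ht (b := 0) (by simp [hg0]) (p := c / t) (by positivity) ((div_le_one ht0).mpr hct)
  refine ⟨y, fun z hz => hy z (hrM z hz) (hgM.1 z hz), hy1, ?_, ?_, ?_⟩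
  · rw [hyc]
    field_simp
    ring
  · rw [hyr]
    have : 0 ≤ c / t := by positivity
    nlinarith [sq_nonneg ‖r‖]
  · rw [hyC, hyr]
    field_simp
    ring

variable [CompleteSpace H] [CompleteSpace K] {a : ℝ}
  (hlarge : ∀ M : Submodule 𝕜 K, FiniteDimensional 𝕜 M → ∃ g ∈ Mᗮ, ‖g‖ = 1 ∧ a < ‖C g‖ ^ 2)

include hlarge in
theorem exists_unit_step_of_lt_of_ne_zero (M : Submodule 𝕜 K) [FiniteDimensional 𝕜 M] {c s t : ℝ}
    (hc : 0 < c) (hcs : c ≤ s) (hsa : s < a) (htc : t < c) {r : K} (hr : r ≠ 0) (hrM : r ∈ Mᗮ)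
    (ht : ‖C r‖ ^ 2 = t * ‖r‖ ^ 2) :
    ∃ y ∈ Mᗮ, ‖y‖ = 1 ∧ ‖C y‖ ^ 2 = c ∧ ‖r - ⟪y, r⟫_𝕜 • y‖ ^ 2 ≤ s / a * ‖r‖ ^ 2 := by
  have ht0 : 0 ≤ t := by
    by_contra! h
    have : 0 < ‖r‖ ^ 2 := by positivity
    nlinarith [sq_nonneg ‖C r‖]
  obtain ⟨g, hgM, hg1, hga⟩ := hlarge (M ⊔ 𝕜 ∙ r ⊔ 𝕜 ∙ (adjoint C (C r))) inferInstance
  rw [← Submodule.inf_orthogonal, ← Submodule.inf_orthogonal, Submodule.mem_inf, Submodule.mem_inf,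
    Submodule.mem_orthogonal_singleton_iff_inner_right,
    Submodule.mem_orthogonal_singleton_iff_inner_right, adjoint_inner_left] at hgM
  obtain ⟨⟨hgM, hgr⟩, hgC⟩ := hgM
  set b := ‖C g‖ ^ 2 with hb
  have hbt : 0 < b - t := by linarith
  obtain ⟨y, hy, hy1, hyc, hyr, -⟩ := exists_unit_mixture C hr hg1 hgr hgC
    ht hb.symm (p := (b - c) / (b - t)) (div_nonneg (by linarith) hbt.le)
    ((div_le_one hbt).mpr (by linarith))
  have hp : 1 - (b - c) / (b - t) = (c - t) / (b - t) := by
    field_simp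
    ring
  refine ⟨y, fun z hz => hy z (hrM z hz) (hgM z hz), hy1, ?_, ?_⟩
  · rw [hyc, hp]
    field_simp
    ring
  · rw [hyr, hp]
    refine mul_le_mul_of_nonneg_right ?_ (sq_nonneg _)
    rw [div_le_div_iff₀ hbt (by linarith)]
    nlinarith [mul_nonneg ht0 (by linarith : 0 ≤ a - s),
      mul_nonneg (hc.le.trans hcs) (by linarith : 0 ≤ b - a),
      mul_nonneg (by linarith : 0 ≤ a) (by linarith : 0 ≤ s - c)]

include hker hlarge in
/-- If the form value of `r` is less than `c`, a suitable unit vector of form value `c` shrinks the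
residual of `r` by a fixed factor. -/
theorem exists_unit_step_of_lt (M : Submodule 𝕜 K) [FiniteDimensional 𝕜 M] {c s t : ℝ}
    (hc : 0 < c) (hcs : c ≤ s) (hsa : s < a) (htc : t < c) {r : K} (hrM : r ∈ Mᗮ)
    (ht : ‖C r‖ ^ 2 = t * ‖r‖ ^ 2) :
    ∃ y ∈ Mᗮ, ‖y‖ = 1 ∧ ‖C y‖ ^ 2 = c ∧ ‖r - ⟪y, r⟫_𝕜 • y‖ ^ 2 ≤ s / a * ‖r‖ ^ 2 := by
  rcases eq_or_ne r 0 with rfl | hr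
  · obtain ⟨g, hgM, hg1, hg0⟩ := hker M inferInstance
    obtain ⟨y, hyM, hy1, hyc, -⟩ := exists_unit_step_of_lt_of_ne_zero C hlarge M hc hcs hsa
      (t := 0) hc (norm_ne_zero_iff.mp (by rw [hg1]; exact one_ne_zero)) hgM (by simp [hg0])
    exact ⟨y, hyM, hy1, hyc, by simp⟩
  · exact exists_unit_step_of_lt_of_ne_zero C hlarge M hc hcs hsa htc hr hrM ht

end Step

section Sequences

/-- What remains of `x` after removing its components along `y 0, …, y (n - 1)`. -/
noncomputable def expansionRemainder (𝕜 : Type*) {K : Type*} [RCLike 𝕜] [NormedAddCommGroup K]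
    [InnerProductSpace 𝕜 K] (y : ℕ → K) (n : ℕ) (x : K) : K :=
  x - ∑ i ∈ Finset.range n, ⟪y i, x⟫_𝕜 • y i

/-- The first `n` terms of `y` are orthonormal and satisfy `‖C (y i)‖² = c i`. -/
def IsOrthonormalUpTo (C : K →L[𝕜] H) (c : ℕ → ℝ) (n : ℕ) (y : ℕ → K) : Prop :=
  ∀ i < n, ‖y i‖ = 1 ∧ ‖C (y i)‖ ^ 2 = c i ∧ ∀ j < i, ⟪y j, y i⟫_𝕜 = 0

variable {C : K →L[𝕜] H} {c : ℕ → ℝ} {n : ℕ} {y y' : ℕ → K}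

@[simp]
theorem expansionRemainder_zero (y : ℕ → K) (x : K) : expansionRemainder 𝕜 y 0 x = x := by
  simp [expansionRemainder]

theorem expansionRemainder_succ (y : ℕ → K) (n : ℕ) (x : K) :
    expansionRemainder 𝕜 y (n + 1) x = expansionRemainder 𝕜 y n x - ⟪y n, x⟫_𝕜 • y n := by
  simp only [expansionRemainder, Finset.sum_range_succ]
  abel

theorem expansionRemainder_sub (y : ℕ → K) (n : ℕ) (x z : K) :
    expansionRemainder 𝕜 y n (x - z) = expansionRemainder 𝕜 y n x - expansionRemainder 𝕜 y n z := by
  simp only [expansionRemainder, inner_sub_right, sub_smul, Finset.sum_sub_distrib]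
  abel

theorem expansionRemainder_congr (h : ∀ i < n, y' i = y i) (x : K) :
    expansionRemainder 𝕜 y' n x = expansionRemainder 𝕜 y n x := by
  unfold expansionRemainder
  congr 1
  exact Finset.sum_congr rfl fun i hi => by rw [h i (Finset.mem_range.mp hi)]

theorem inner_expansionRemainder_eq (x z : K) (h : ∀ i < n, ⟪z, y i⟫_𝕜 = 0) :
    ⟪z, expansionRemainder 𝕜 y n x⟫_𝕜 = ⟪z, x⟫_𝕜 := by
  rw [expansionRemainder, inner_sub_right, inner_sum, Finset.sum_eq_zero, sub_zero]
  intro i hi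
  rw [inner_smul_right, h i (Finset.mem_range.mp hi), mul_zero]

namespace IsOrthonormalUpTo

theorem mono {m : ℕ} (h : IsOrthonormalUpTo C c n y) (hm : m ≤ n) : IsOrthonormalUpTo C c m y :=
  fun i hi => h i (hi.trans_le hm)

theorem congr (h : IsOrthonormalUpTo C c n y) (hy : ∀ i < n, y' i = y i) :
    IsOrthonormalUpTo C c n y' := by
  intro i hi
  rw [hy i hi]
  exact ⟨(h i hi).1, (h i hi).2.1, fun j hj => by rw [hy j (hj.trans hi)]; exact (h i hi).2.2 j hj⟩

theorem expansionRemainder_succ_eq (h : IsOrthonormalUpTo C c (n + 1) y) (x : K) :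
    expansionRemainder 𝕜 y (n + 1) x
      = expansionRemainder 𝕜 y n x - ⟪y n, expansionRemainder 𝕜 y n x⟫_𝕜 • y n := by
  rw [expansionRemainder_succ, inner_expansionRemainder_eq x (y n)]
  exact fun i hi => inner_eq_zero_symm.mp ((h n n.lt_succ_self).2.2 i hi)

theorem inner_expansionRemainder (h : IsOrthonormalUpTo C c n y) (x : K) :
    ∀ i < n, ⟪y i, expansionRemainder 𝕜 y n x⟫_𝕜 = 0 := by
  induction n with
  | zero => simp
  | succ n ih =>
    intro i hi
    rw [h.expansionRemainder_succ_eq, inner_sub_right, inner_smul_right]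
    rcases Nat.lt_succ_iff_lt_or_eq.mp hi with hin | rfl
    · rw [ih (h.mono n.le_succ) i hin, (h n n.lt_succ_self).2.2 i hin]
      simp
    · rw [inner_self_eq_norm_sq_to_K, (h i hi).1]
      simp

theorem expansionRemainder_mem_orthogonal (h : IsOrthonormalUpTo C c n y) (x : K) :
    expansionRemainder 𝕜 y n x ∈ (Submodule.span 𝕜 (y '' Set.Iio n))ᗮ := by
  rw [Submodule.mem_orthogonal]
  intro u hu
  induction hu using Submodule.span_induction with
  | mem u hu =>
    obtain ⟨i, hi, rfl⟩ := hu
    exact h.inner_expansionRemainder x i hi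
  | zero => exact inner_zero_left _
  | add u v _ _ hu hv => rw [inner_add_left, hu, hv, add_zero]
  | smul r u _ hu => rw [inner_smul_left, hu, mul_zero]

theorem norm_expansionRemainder_succ_le (h : IsOrthonormalUpTo C c (n + 1) y) (x : K) :
    ‖expansionRemainder 𝕜 y (n + 1) x‖ ≤ ‖expansionRemainder 𝕜 y n x‖ := by
  have h1 : expansionRemainder 𝕜 y n x = expansionRemainder 𝕜 y (n + 1) x + ⟪y n, x⟫_𝕜 • y n := by
    rw [expansionRemainder_succ]
    abel
  have h2 : ⟪expansionRemainder 𝕜 y (n + 1) x, ⟪y n, x⟫_𝕜 • y n⟫_𝕜 = 0 := by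
    rw [inner_smul_right, inner_eq_zero_symm.mp (h.inner_expansionRemainder x n n.lt_succ_self),
      mul_zero]
  have h3 := norm_add_sq_eq_norm_sq_add_norm_sq_of_inner_eq_zero _ _ h2
  rw [← h1] at h3
  nlinarith [norm_nonneg (expansionRemainder 𝕜 y (n + 1) x),
    norm_nonneg (expansionRemainder 𝕜 y n x),
    norm_nonneg (⟪y n, x⟫_𝕜 • y n)]

theorem update {z : K} (h : IsOrthonormalUpTo C c n y)
    (hz : z ∈ (Submodule.span 𝕜 (y '' Set.Iio n))ᗮ) (hz1 : ‖z‖ = 1) (hzc : ‖C z‖ ^ 2 = c n) :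
    IsOrthonormalUpTo C c (n + 1) (Function.update y n z) := by
  intro i hi
  rcases Nat.lt_succ_iff_lt_or_eq.mp hi with hin | rfl
  · rw [Function.update_of_ne hin.ne]
    refine ⟨(h i hin).1, (h i hin).2.1, fun j hj => ?_⟩
    rw [Function.update_of_ne (hj.trans hin).ne]
    exact (h i hin).2.2 j hj
  · rw [Function.update_self]
    refine ⟨hz1, hzc, fun j hj => ?_⟩
    rw [Function.update_of_ne hj.ne]
    exact hz _ (Submodule.subset_span ⟨j, hj, rfl⟩)

theorem expansionRemainder_update {z : K} (h : IsOrthonormalUpTo C c n y)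
    (hz : z ∈ (Submodule.span 𝕜 (y '' Set.Iio n))ᗮ) (hz1 : ‖z‖ = 1) (hzc : ‖C z‖ ^ 2 = c n)
    (x : K) :
    expansionRemainder 𝕜 (Function.update y n z) (n + 1) x
      = expansionRemainder 𝕜 y n x - ⟪z, expansionRemainder 𝕜 y n x⟫_𝕜 • z := by
  rw [(h.update hz hz1 hzc).expansionRemainder_succ_eq, Function.update_self,
    expansionRemainder_congr fun i hi => Function.update_of_ne (Nat.ne_of_lt hi) _ _]

end IsOrthonormalUpTo

theorem norm_expansionRemainder_le_of_le (h : ∀ n, IsOrthonormalUpTo C c n y) (x : K) {m : ℕ}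
    (hm : n ≤ m) :
    ‖expansionRemainder 𝕜 y m x‖ ≤ ‖expansionRemainder 𝕜 y n x‖ :=
  antitone_nat_of_succ_le (f := fun n => ‖expansionRemainder 𝕜 y n x‖)
    (fun n => (h (n + 1)).norm_expansionRemainder_succ_le x) hm

section Extension

variable [CompleteSpace H] [CompleteSpace K] {a s : ℝ}
  (hker : ∀ M : Submodule 𝕜 K, FiniteDimensional 𝕜 M → ∃ g ∈ Mᗮ, ‖g‖ = 1 ∧ C g = 0)
  (hlarge : ∀ M : Submodule 𝕜 K, FiniteDimensional 𝕜 M → ∃ g ∈ Mᗮ, ‖g‖ = 1 ∧ a < ‖C g‖ ^ 2)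
  (hc : ∀ i, 0 < c i) (hcs : ∀ i, c i ≤ s) (hsa : s < a)

include hker hlarge hc hcs hsa

/-- Provided the next `N` values of `c` sum to more than the form value of the remainder of `x`, a
finite orthonormal family can be extended so that this remainder shrinks by a fixed factor. -/
theorem exists_extension_shrink_of_lt_sum (x : K) (N : ℕ) :
    ∀ (n : ℕ) (y : ℕ → K) (t : ℝ), IsOrthonormalUpTo C c n y →
      ‖C (expansionRemainder 𝕜 y n x)‖ ^ 2 = t * ‖expansionRemainder 𝕜 y n x‖ ^ 2 →
      t < ∑ i ∈ Finset.range N, c (n + i) →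
      ∃ m > n, ∃ y' : ℕ → K, IsOrthonormalUpTo C c m y' ∧ (∀ i < n, y' i = y i) ∧
        ‖expansionRemainder 𝕜 y' m x‖ ^ 2 ≤ s / a * ‖expansionRemainder 𝕜 y n x‖ ^ 2 := by
  have hs : 0 < s := (hc 0).trans_le (hcs 0)
  have hρ : 0 ≤ s / a := div_nonneg hs.le (hs.trans hsa).le
  have small : ∀ (n : ℕ) (y : ℕ → K) (t : ℝ), IsOrthonormalUpTo C c n y →
      ‖C (expansionRemainder 𝕜 y n x)‖ ^ 2 = t * ‖expansionRemainder 𝕜 y n x‖ ^ 2 → t < c n →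
      ∃ m > n, ∃ y' : ℕ → K, IsOrthonormalUpTo C c m y' ∧ (∀ i < n, y' i = y i) ∧
        ‖expansionRemainder 𝕜 y' m x‖ ^ 2 ≤ s / a * ‖expansionRemainder 𝕜 y n x‖ ^ 2 := by
    intro n y t hy ht htc
    have := FiniteDimensional.span_of_finite 𝕜 ((Set.finite_Iio n).image y)
    obtain ⟨z, hzM, hz1, hzc, hz⟩ := exists_unit_step_of_lt C hker hlarge
      (Submodule.span 𝕜 (y '' Set.Iio n)) (hc n) (hcs n) hsa htc
      (hy.expansionRemainder_mem_orthogonal x) ht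
    refine ⟨n + 1, n.lt_succ_self, _, hy.update hzM hz1 hzc,
      fun i hi => Function.update_of_ne (Nat.ne_of_lt hi) _ _, ?_⟩
    rwa [hy.expansionRemainder_update hzM hz1 hzc]
  induction N with
  | zero =>
    intro n y t hy ht htN
    exact small n y t hy ht (by simpa using htN.trans (hc n))
  | succ N ih =>
    intro n y t hy ht htN
    rcases eq_or_ne (expansionRemainder 𝕜 y n x) 0 with h0 | h0
    · exact small n y 0 hy (by simp [h0]) (hc n)
    rcases lt_or_ge t (c n) with htc | htc
    · exact small n y t hy ht htc
    have := FiniteDimensional.span_of_finite 𝕜 ((Set.finite_Iio n).image y)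
    obtain ⟨z, hzM, hz1, hzc, hz, hzt⟩ := exists_unit_step_of_le C hker
      (Submodule.span 𝕜 (y '' Set.Iio n)) (hc n) htc h0 (hy.expansionRemainder_mem_orthogonal x) ht
    rw [← hy.expansionRemainder_update hzM hz1 hzc] at hz hzt
    rw [Finset.sum_range_succ'] at htN
    obtain ⟨m, hm, y', hy', hagree, hle⟩ := ih (n + 1) _ (t - c n) (hy.update hzM hz1 hzc) hzt (by
      have : ∀ i, n + 1 + i = n + (i + 1) := fun i => by ring
      simp only [this]
      rw [add_zero] at htN
      linarith)
    refine ⟨m, (Nat.lt_succ_self n).trans hm, y', hy', fun i hi => ?_,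
      hle.trans (mul_le_mul_of_nonneg_left hz hρ)⟩
    rw [hagree i (hi.trans n.lt_succ_self), Function.update_of_ne hi.ne]

variable (hdiv : Filter.Tendsto (fun N => ∑ i ∈ Finset.range N, c i) Filter.atTop Filter.atTop)

include hdiv

theorem exists_extension_shrink (x : K) (n : ℕ) (y : ℕ → K) (hy : IsOrthonormalUpTo C c n y) :
    ∃ m > n, ∃ y' : ℕ → K, IsOrthonormalUpTo C c m y' ∧ (∀ i < n, y' i = y i) ∧
      ‖expansionRemainder 𝕜 y' m x‖ ^ 2 ≤ s / a * ‖expansionRemainder 𝕜 y n x‖ ^ 2 := by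
  set t : ℝ := ‖C (expansionRemainder 𝕜 y n x)‖ ^ 2 / ‖expansionRemainder 𝕜 y n x‖ ^ 2 with ht
  obtain ⟨N, hnN, hN⟩ := (hdiv.eventually_gt_atTop (t + ∑ i ∈ Finset.range n, c i)).and
    (Filter.eventually_ge_atTop n) |>.exists.imp fun _ h => h.symm
  obtain ⟨N, rfl⟩ := Nat.exists_eq_add_of_le hnN
  rw [Finset.sum_range_add] at hN
  refine exists_extension_shrink_of_lt_sum hker hlarge hc hcs hsa x N n y t hy ?_ (by linarith)
  rcases eq_or_ne (expansionRemainder 𝕜 y n x) 0 with h0 | h0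
  · simp [h0]
  · rw [ht, div_mul_cancel₀]
    exact pow_ne_zero _ (norm_ne_zero_iff.mpr h0)

theorem exists_extension_norm_expansionRemainder_lt (x : K) {ε : ℝ} (hε : 0 < ε) (n : ℕ) (y : ℕ → K)
    (hy : IsOrthonormalUpTo C c n y) :
    ∃ m > n, ∃ y' : ℕ → K, IsOrthonormalUpTo C c m y' ∧ (∀ i < n, y' i = y i) ∧
      ‖expansionRemainder 𝕜 y' m x‖ < ε := by
  have hs : 0 < s := (hc 0).trans_le (hcs 0)
  have ha : 0 < a := hs.trans hsa
  have hρ : 0 ≤ s / a := div_nonneg hs.le ha.le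
  have iter : ∀ k : ℕ, ∃ m > n, ∃ y' : ℕ → K, IsOrthonormalUpTo C c m y' ∧ (∀ i < n, y' i = y i) ∧
      ‖expansionRemainder 𝕜 y' m x‖ ^ 2 ≤ (s / a) ^ (k + 1) * ‖expansionRemainder 𝕜 y n x‖ ^ 2 := by
    intro k
    induction k with
    | zero => simpa using exists_extension_shrink hker hlarge hc hcs hsa hdiv x n y hy
    | succ k ih =>
      obtain ⟨m, hm, y', hy', hagree, hle⟩ := ih
      obtain ⟨m₂, hm₂, y₂, hy₂, hagree₂, hle₂⟩ :=
        exists_extension_shrink hker hlarge hc hcs hsa hdiv x m y' hy'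
      refine ⟨m₂, hm.trans hm₂, y₂, hy₂, fun i hi => ?_, ?_⟩
      · rw [hagree₂ i (hi.trans hm), hagree i hi]
      · calc _ ≤ s / a * ((s / a) ^ (k + 1) * ‖expansionRemainder 𝕜 y n x‖ ^ 2) :=
              hle₂.trans (mul_le_mul_of_nonneg_left hle hρ)
          _ = _ := by ring
  obtain ⟨k, hk⟩ : ∃ k : ℕ, (s / a) ^ (k + 1) * ‖expansionRemainder 𝕜 y n x‖ ^ 2 < ε ^ 2 := by
    have h1 := ((tendsto_pow_atTop_nhds_zero_of_lt_one hρ ((div_lt_one ha).mpr hsa)).comp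
      (Filter.tendsto_add_atTop_nat 1)).mul_const (‖expansionRemainder 𝕜 y n x‖ ^ 2)
    rw [zero_mul] at h1
    exact (h1.eventually_lt_const (by positivity)).exists
  obtain ⟨m, hm, y', hy', hagree, hle⟩ := iter k
  exact ⟨m, hm, y', hy', hagree, lt_of_pow_lt_pow_left₀ 2 hε.le (hle.trans_lt hk)⟩

/-- There is an infinite orthonormal sequence `y` with `‖C (y i)‖² = c i` for which countably many
prescribed vectors are approximated to prescribed accuracy by their partial expansions. -/
theorem exists_orthonormal_sequence (e : ℕ → K) (δ : ℕ → ℝ) (hδ : ∀ k, 0 < δ k) :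
    ∃ y : ℕ → K, (∀ n, IsOrthonormalUpTo C c n y) ∧
      ∀ k, ∃ n, ‖expansionRemainder 𝕜 y n (e k)‖ < δ k := by
  have next : ∀ (k : ℕ) (p : {p : ℕ × (ℕ → K) // IsOrthonormalUpTo C c p.1 p.2}),
      ∃ q : {p : ℕ × (ℕ → K) // IsOrthonormalUpTo C c p.1 p.2}, p.1.1 < q.1.1 ∧
        (∀ i < p.1.1, q.1.2 i = p.1.2 i) ∧ ‖expansionRemainder 𝕜 q.1.2 q.1.1 (e k)‖ < δ k := by
    rintro k ⟨⟨n, y⟩, hy⟩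
    obtain ⟨m, hm, y', hy', hagree, hlt⟩ :=
      exists_extension_norm_expansionRemainder_lt hker hlarge hc hcs hsa hdiv (e k) (hδ k) n y hy
    exact ⟨⟨⟨m, y'⟩, hy'⟩, hm, hagree, hlt⟩
  choose F hFlt hFagree hFres using next
  let st : ℕ → {p : ℕ × (ℕ → K) // IsOrthonormalUpTo C c p.1 p.2} :=
    Nat.rec ⟨⟨0, 0⟩, fun i hi => absurd hi i.not_lt_zero⟩ F
  have hlt : ∀ k, (st k).1.1 < (st (k + 1)).1.1 := fun k => hFlt k (st k)
  have hmono : StrictMono fun k => (st k).1.1 := strictMono_nat_of_lt_succ hlt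
  have hagree : ∀ k l, k ≤ l → ∀ i < (st k).1.1, (st l).1.2 i = (st k).1.2 i := by
    intro k l hkl
    induction l, hkl using Nat.le_induction with
    | base => exact fun _ _ => rfl
    | succ l hkl ih =>
      intro i hi
      rw [← ih i hi]
      exact hFagree l (st l) i (hi.trans_le (hmono.monotone hkl))
  have hid : ∀ i, i < (st (i + 1)).1.1 := fun i => Nat.lt_of_succ_le (hmono.le_apply (x := i + 1))
  have hlim : ∀ k, ∀ i < (st k).1.1, (st (i + 1)).1.2 i = (st k).1.2 i := by
    intro k i hi
    rcases le_total k (i + 1) with h | h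
    · exact hagree k (i + 1) h i hi
    · exact (hagree (i + 1) k h i (hid i)).symm
  refine ⟨fun i => (st (i + 1)).1.2 i, fun n => ?_, fun k => ⟨(st (k + 1)).1.1, ?_⟩⟩
  · exact ((st n).2.congr (hlim n)).mono (hmono.le_apply (x := n))
  · rw [expansionRemainder_congr (hlim (k + 1))]
    exact hFres k (st k)

end Extension

end Sequences

end Greedy

section Dilation

universe u v

open ContinuousLinearMap

variable {𝕜 H E : Type*} [RCLike 𝕜] [NormedAddCommGroup H] [InnerProductSpace 𝕜 H]
  [NormedAddCommGroup E] [InnerProductSpace 𝕜 E]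

/-- If `F` is infinite-dimensional, the orthogonal complement of any finite-dimensional subspace of
`E ⊕ F` contains a unit vector with zero first component. -/
theorem exists_mem_orthogonal_fst_eq_zero {F : Type*} [NormedAddCommGroup F]
    [InnerProductSpace 𝕜 F] (hF : ¬ FiniteDimensional 𝕜 F)
    (M : Submodule 𝕜 (WithLp 2 (E × F))) [FiniteDimensional 𝕜 M] :
    ∃ g ∈ Mᗮ, ‖g‖ = 1 ∧ WithLp.fstL 2 𝕜 E F g = 0 := by
  let ι : F →ₗ[𝕜] WithLp 2 (E × F) :=
    (WithLp.linearEquiv 2 𝕜 (E × F)).symm.toLinearMap ∘ₗ LinearMap.inr 𝕜 E F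
  have hι : ∀ w, WithLp.fstL 2 𝕜 E F (ι w) = 0 := fun w => rfl
  have hιs : ∀ w, WithLp.sndL 2 𝕜 E F (ι w) = w := fun w => rfl
  have hinj : ¬ Function.Injective (M.orthogonalProjectionOnto.toLinearMap ∘ₗ ι) := fun h =>
    hF (FiniteDimensional.of_injective _ h)
  rw [← LinearMap.ker_eq_bot, Submodule.eq_bot_iff] at hinj
  push Not at hinj
  obtain ⟨w, hw, hw0⟩ := hinj
  have hne : ι w ≠ 0 := fun h => hw0 (by rw [← hιs w, h, map_zero])
  have hmem : ι w ∈ Mᗮ := Submodule.orthogonalProjectionOnto_eq_zero_iff.mp hw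
  refine ⟨((‖ι w‖⁻¹ : ℝ) : 𝕜) • ι w, Mᗮ.smul_mem _ hmem, ?_, ?_⟩
  · rw [norm_smul]
    simp [norm_ne_zero_iff.mpr hne]
  · rw [map_smul, hι, smul_zero]

/-- A positive operator on an infinite-dimensional Hilbert space is `C C†`, where the kernel of `C`
meets the orthogonal complement of every finite-dimensional subspace. -/
theorem ContinuousLinearMap.IsPositive.exists_comp_adjoint_eq {𝕜 : Type u} {H : Type v} [RCLike 𝕜]
    [NormedAddCommGroup H] [InnerProductSpace 𝕜 H] [CompleteSpace H]
    (hinf : ¬ FiniteDimensional 𝕜 H) {B : H →L[𝕜] H} (hB : B.IsPositive) :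
    ∃ (K : Type (max u v)) (_ : NormedAddCommGroup K) (_ : InnerProductSpace 𝕜 K)
      (_ : CompleteSpace K) (C : K →L[𝕜] H), C ∘L adjoint C = B ∧
      ∀ M : Submodule 𝕜 K, FiniteDimensional 𝕜 M → ∃ g ∈ Mᗮ, ‖g‖ = 1 ∧ C g = 0 := by
  obtain ⟨E, _, _, _, S, hS⟩ := hB.exists_adjoint_comp_eq
  refine ⟨WithLp 2 (E × H), inferInstance, inferInstance, inferInstance,
    adjoint S ∘L WithLp.fstL 2 𝕜 E H, ?_, fun M hM => ?_⟩
  · rw [← hS]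
    have hadj : WithLp.fstL 2 𝕜 E H ∘L adjoint (WithLp.fstL 2 𝕜 E H) = 1 := by
      have key : ∀ u : E, adjoint (WithLp.fstL 2 𝕜 E H) u = WithLp.toLp 2 (u, 0) := by
        intro u
        refine ext_inner_left 𝕜 fun z => ?_
        rw [adjoint_inner_right, WithLp.prod_inner_apply]
        simp
      ext u
      simp [key]
    rw [adjoint_comp, adjoint_adjoint]
    ext v
    have h1 := DFunLike.congr_fun hadj (S v)
    simp only [coe_comp, Function.comp_apply] at h1 ⊢
    rw [h1]
    rfl
  · obtain ⟨g, hgM, hg1, hg0⟩ := exists_mem_orthogonal_fst_eq_zero hinf M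
    exact ⟨g, hgM, hg1, by rw [comp_apply, hg0, map_zero]⟩

end Dilation

theorem tendsto_expansionRemainder_zero {𝕜 H K : Type*} [RCLike 𝕜] [NormedAddCommGroup H]
    [InnerProductSpace 𝕜 H] [NormedAddCommGroup K] [InnerProductSpace 𝕜 K] {C : K →L[𝕜] H}
    {c : ℕ → ℝ} {y : ℕ → K} (hy : ∀ n, IsOrthonormalUpTo C c n y) (x : K)
    (hx : ∀ ε > 0, ∃ e n, ‖x - e‖ < ε ∧ ‖expansionRemainder 𝕜 y n e‖ < ε) :
    Filter.Tendsto (fun n => expansionRemainder 𝕜 y n x) Filter.atTop (nhds 0) := by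
  rw [Metric.tendsto_atTop]
  intro ε hε
  obtain ⟨e, n, hxe, he⟩ := hx (ε / 2) (half_pos hε)
  refine ⟨n, fun m hm => ?_⟩
  have h1 : ‖expansionRemainder 𝕜 y m (x - e)‖ ≤ ‖x - e‖ := by
    simpa using norm_expansionRemainder_le_of_le hy (x - e) m.zero_le
  have h2 := norm_expansionRemainder_le_of_le hy e hm
  rw [dist_zero_right, ← sub_add_cancel (expansionRemainder 𝕜 y m x) (expansionRemainder 𝕜 y m e),
    ← expansionRemainder_sub]
  linarith [norm_add_le (expansionRemainder 𝕜 y m (x - e)) (expansionRemainder 𝕜 y m e)]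

/-- Let `B` be a positive non-compact bounded operator on an infinite-dimensional separable
real or complex Hilbert space `H`. If `{c i}` is a bounded sequence of positive reals with
`sup_i c i < ‖B‖_ess` and `∑ c i = ∞`, then there is a sequence of rank-one projections
`P i = x i ⊗ x i` (with `‖x i‖ = 1`) such that `B = ∑ i, c i • P i` in the strong operator
topology. -/
theorem rank_one_decomposition_noncompact {𝕜 H : Type*} [RCLike 𝕜] [NormedAddCommGroup H]
    [InnerProductSpace 𝕜 H] [CompleteSpace H] [TopologicalSpace.SeparableSpace H]
    (hinf : ¬ FiniteDimensional 𝕜 H)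
    (B : H →L[𝕜] H) (hB : B.IsPositive) (hBnc : ¬ IsCompactOperator B)
    (c : ℕ → ℝ) (hcpos : ∀ i, 0 < c i)
    (hbdd : BddAbove (Set.range c))
    (hsup : ⨆ i, c i < essNorm B)
    (hdiv : Filter.Tendsto (fun N => ∑ i ∈ Finset.range N, c i) Filter.atTop Filter.atTop) :
    ∃ x : ℕ → H, (∀ i, ‖x i‖ = 1) ∧
      ∀ v : H, Filter.Tendsto
        (fun N => ∑ i ∈ Finset.range N, (c i : 𝕜) • (rankOne 𝕜 (x i) (x i) v))
        Filter.atTop (nhds (B v)) := by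

  obtain ⟨K, _, _, _, C, hC, hker⟩ := hB.exists_comp_adjoint_eq hinf
  have hcs : ∀ i, c i ≤ ⨆ i, c i := le_ciSup hbdd
  obtain ⟨a, hsa, ha⟩ := exists_between hsup
  have ha0 : 0 ≤ a := (((hcpos 0).trans_le (hcs 0)).trans hsa).le
  have hlarge : ∀ M : Submodule 𝕜 K, FiniteDimensional 𝕜 M →
      ∃ g ∈ Mᗮ, ‖g‖ = 1 ∧ a < ‖C g‖ ^ 2 := fun M _ =>
    exists_mem_orthogonal_lt_norm_sq_of_lt_essNorm C ha0 (by rwa [hC]) M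
  let A := ContinuousLinearMap.adjoint C
  obtain ⟨y, hy, hres⟩ := exists_orthonormal_sequence hker hlarge hcpos hcs hsa hdiv
    (fun k => A (TopologicalSpace.denseSeq H k.unpair.1)) (fun k => 1 / ((k.unpair.2 : ℝ) + 1))
    (fun k => by positivity)
  have hzero : ∀ v : H, Filter.Tendsto (fun n => expansionRemainder 𝕜 y n (A v)) Filter.atTop
      (nhds 0) := by
    intro v
    refine tendsto_expansionRemainder_zero hy _ fun ε hε => ?_
    have hnear : ∀ᶠ w in nhds v, ‖A v - A w‖ < ε := by
      have : Filter.Tendsto (fun w => ‖A v - A w‖) (nhds v) (nhds ‖A v - A v‖) :=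
        Continuous.tendsto (by fun_prop) v
      rw [sub_self, norm_zero] at this
      exact this.eventually_lt_const hε
    obtain ⟨j, hj⟩ := (TopologicalSpace.denseRange_denseSeq H).exists_mem_open
      isOpen_interior ⟨v, mem_interior_iff_mem_nhds.mpr hnear⟩
    obtain ⟨l, hl⟩ := exists_nat_one_div_lt hε
    obtain ⟨n, hn⟩ := hres (Nat.pair j l)
    rw [Nat.unpair_pair] at hn
    have hvj : TopologicalSpace.denseSeq H j ∈ {w | ‖A v - A w‖ < ε} := interior_subset hj
    exact ⟨_, n, hvj, hn.trans hl⟩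
  have hy' : ∀ i, ‖y i‖ = 1 ∧ ‖C (y i)‖ ^ 2 = c i := fun i =>
    ⟨(hy (i + 1) i i.lt_succ_self).1, (hy (i + 1) i i.lt_succ_self).2.1⟩
  refine ⟨fun i => (((√(c i))⁻¹ : ℝ) : 𝕜) • C (y i), fun i => ?_, fun v => ?_⟩
  · have hsq : √(c i) = ‖C (y i)‖ := by
      rw [← (hy' i).2, Real.sqrt_sq (norm_nonneg _)]
    have hpos : 0 < √(c i) := Real.sqrt_pos.mpr (hcpos i)
    rw [norm_smul, RCLike.norm_ofReal, abs_of_pos (inv_pos.mpr hpos), ← hsq,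
      inv_mul_cancel₀ hpos.ne']
  · have hterm : ∀ i, (c i : 𝕜) • rankOne 𝕜 ((((√(c i))⁻¹ : ℝ) : 𝕜) • C (y i))
        ((((√(c i))⁻¹ : ℝ) : 𝕜) • C (y i)) v = C (⟪y i, A v⟫_𝕜 • y i) := by
      intro i
      have h1 : (c i : 𝕜) * ((((√(c i))⁻¹ : ℝ) : 𝕜) * (((√(c i))⁻¹ : ℝ) : 𝕜)) = 1 := by
        rw [← RCLike.ofReal_mul, ← RCLike.ofReal_mul, ← mul_inv,
          Real.mul_self_sqrt (hcpos i).le, mul_inv_cancel₀ (hcpos i).ne', RCLike.ofReal_one]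
      rw [map_smul, ContinuousLinearMap.adjoint_inner_right]
      simp only [rankOne, ContinuousLinearMap.smulRight_apply, innerSL_apply_apply,
        inner_smul_left, RCLike.conj_ofReal, smul_smul]
      congr 1
      linear_combination ⟪C (y i), v⟫_𝕜 * h1
    have hsum : ∀ N, ∑ i ∈ Finset.range N, C (⟪y i, A v⟫_𝕜 • y i)
        = B v - C (expansionRemainder 𝕜 y N (A v)) := by
      intro N
      rw [expansionRemainder, map_sub, map_sum, ← hC]
      simp [A]
    simp only [hterm, hsum]
    simpa using ((C.continuous.tendsto 0).comp (hzero v)).const_sub (B v)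
end

section
/- Let H be an infinite-dimensional separable real or complex Hilbert space. There is no sequence {P_i}_{i=1}^∞ of rank-one orthogonal projections on H such that I = (2/3)P_1 + Σ_{i=2}^∞ P_i with convergence in the strong operator topology. Equivalently, there is no Parseval frame {x_i}_{i=1}^∞ for H with ‖x_1‖ = √(2/3) and ‖x_i‖ = 1 for all i ≥ 2. -/
open scoped InnerProductSpace

/-- In a Parseval frame all of whose vectors other than `y 0` are unit vectors, every vector other
than `y 0` is orthogonal to `y 0`, so that `‖y 0‖ ^ 2 = ‖y 0‖ ^ 4`. -/
theorem norm_sq_eq_norm_sq_sq_of_parseval {𝕜 H : Type*} [RCLike 𝕜] [NormedAddCommGroup H]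
    [InnerProductSpace 𝕜 H] {y : ℕ → H} (hy : ∀ i, 1 ≤ i → ‖y i‖ = 1)
    (hsum : ∀ v : H, HasSum (fun i => ‖⟪y i, v⟫_𝕜‖ ^ 2) (‖v‖ ^ 2)) :
    ‖y 0‖ ^ 2 = (‖y 0‖ ^ 2) ^ 2 := by
  have self_inner (i : ℕ) : ‖⟪y i, y i⟫_𝕜‖ = ‖y i‖ ^ 2 := by
    rw [inner_self_eq_norm_sq_to_K]
    simp
  have orth : ∀ i, i ≠ 0 → ‖⟪y i, y 0⟫_𝕜‖ ^ 2 = 0 := by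
    intro i hi
    have h := sum_le_hasSum {0, i} (fun j _ => by positivity) (hsum (y i))
    rw [Finset.sum_pair hi.symm, self_inner, hy i (Nat.one_le_iff_ne_zero.2 hi),
      norm_inner_symm] at h
    nlinarith [sq_nonneg ‖⟪y i, y 0⟫_𝕜‖]
  have h := (hsum (y 0)).unique (hasSum_single 0 orth)
  rwa [self_inner] at h

/-- The quadratic form of `x ⊗ x` is `v ↦ |⟨x, v⟩| ^ 2`. -/
theorem inner_rankOne_self {𝕜 H : Type*} [RCLike 𝕜] [NormedAddCommGroup H]
    [InnerProductSpace 𝕜 H] (x v : H) :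
    ⟪v, rankOne 𝕜 x x v⟫_𝕜 = ((‖⟪x, v⟫_𝕜‖ ^ 2 : ℝ) : 𝕜) := by
  simp only [rankOne, ContinuousLinearMap.smulRight_apply, innerSL_apply_apply, inner_smul_right]
  rw [← inner_conj_symm v x, RCLike.mul_conj]
  push_cast
  rfl

/-- On an infinite-dimensional separable real or complex Hilbert space, there is no sequence of
rank-one orthogonal projections `P i = x i ⊗ x i` with `I = (2/3) P 0 + ∑_{i≥1} P i` in the
strong operator topology; equivalently there is no Parseval frame `{y i}` with
`‖y 0‖ = √(2/3)` and `‖y i‖ = 1` for `i ≥ 1`. -/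
theorem no_parseval_frame_two_thirds {𝕜 H : Type*} [RCLike 𝕜] [NormedAddCommGroup H]
    [InnerProductSpace 𝕜 H] [CompleteSpace H] [TopologicalSpace.SeparableSpace H]
    (hinf : ¬ FiniteDimensional 𝕜 H) :
    (¬ ∃ x : ℕ → H, (∀ i, ‖x i‖ = 1) ∧
        ∀ v : H, Filter.Tendsto
          (fun N => ∑ i ∈ Finset.range N,
            ((if i = 0 then (2 / 3 : ℝ) else 1) : 𝕜) • (rankOne 𝕜 (x i) (x i) v))
          Filter.atTop (nhds v)) ∧
    (¬ ∃ y : ℕ → H, ‖y 0‖ = Real.sqrt (2 / 3) ∧ (∀ i, 1 ≤ i → ‖y i‖ = 1) ∧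
        ∀ v : H, HasSum (fun i => ‖⟪y i, v⟫_𝕜‖ ^ 2) (‖v‖ ^ 2)) := by
  have frame : ¬ ∃ y : ℕ → H, ‖y 0‖ = Real.sqrt (2 / 3) ∧ (∀ i, 1 ≤ i → ‖y i‖ = 1) ∧
      ∀ v : H, HasSum (fun i => ‖⟪y i, v⟫_𝕜‖ ^ 2) (‖v‖ ^ 2) := by
    rintro ⟨y, h0, hy, hsum⟩
    have h := norm_sq_eq_norm_sq_sq_of_parseval hy hsum
    rw [h0, Real.sq_sqrt (by norm_num)] at h
    norm_num at h
  refine ⟨?_, frame⟩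
  rintro ⟨x, hx, hlim⟩
  refine frame ⟨fun i => ((if i = 0 then Real.sqrt (2 / 3) else 1 : ℝ) : 𝕜) • x i, ?_, ?_, ?_⟩
  · simp [norm_smul, hx, abs_of_nonneg (Real.sqrt_nonneg _)]
  · intro i hi
    simp [hx, Nat.one_le_iff_ne_zero.1 hi]
  · intro v
    rw [hasSum_iff_tendsto_nat_of_nonneg (fun i => by positivity)]
    have h := (RCLike.continuous_re.tendsto _).comp
      (((innerSL 𝕜 v).continuous.tendsto v).comp (hlim v))
    simp only [innerSL_apply_apply, inner_self_eq_norm_sq] at h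
    refine h.congr fun N => ?_
    simp only [Function.comp_apply, innerSL_apply_apply, map_sum, inner_smul_right,
      inner_rankOne_self]
    refine Finset.sum_congr rfl fun i _ => ?_
    rw [inner_smul_left, norm_mul, mul_pow]
    split_ifs
    · rw [RCLike.re_ofReal_mul, RCLike.ofReal_re, RCLike.conj_ofReal, RCLike.norm_ofReal, sq_abs,
        Real.sq_sqrt (by norm_num)]
    · simp only [map_one, norm_one, one_mul, one_pow, RCLike.ofReal_re]
end
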